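/- arXiv:2507.22597 — 2 statements merged into one kernel-verified Lean document; each statement's English description precedes it below -/
import Mathlib

section
/- Assume 1 = w_0 ≤ w_1 = ⋯ = w_ℓ and w_1 ∣ d. Let f be a nonzero 𝔽_q-linear combination of monomials in M̄_d whose initial monomial is of the form in(f) = x_1^{a_1} ⋯ x_ℓ^{a_ℓ}, i.e. divisible only by the variables x_1, …, x_ℓ. Then |V_{ℙ(w)}(f)(𝔽_q)| ≤ (d/w_1)·q^{m−1} + p_{m−2}. -/
open MvPolynomial

noncomputable section

/-- `pSum q k = 1 + q + ⋯ + q^(k-1)`; so `p_m = pSum q (m+1)`. -/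
def pSum (q k : ℕ) : ℕ := ∑ i ∈ Finset.range k, q ^ i

/-- Equivalence of nonzero vectors under weighted scaling by the algebraic closure. -/
def wRel (F : Type) [Field F] {m : ℕ} (w : Fin (m + 1) → ℕ)
    (x y : {v : Fin (m + 1) → AlgebraicClosure F // v ≠ 0}) : Prop :=
  ∃ lam : (AlgebraicClosure F)ˣ, ∀ i, y.1 i = (lam : AlgebraicClosure F) ^ w i * x.1 i

/-- The weighted projective space `ℙ(w)` as set of orbits. -/
def PW (F : Type) [Field F] {m : ℕ} (w : Fin (m + 1) → ℕ) : Type :=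
  Quot (wRel F w)

def PW.mk (F : Type) [Field F] {m : ℕ} (w : Fin (m + 1) → ℕ)
    (x : {v : Fin (m + 1) → AlgebraicClosure F // v ≠ 0}) : PW F w :=
  Quot.mk _ x

/-- The `𝔽_q`-rational points of `ℙ(w)`: orbits fixed by coordinatewise Frobenius. -/
def ratPts (F : Type) [Field F] [Fintype F] {m : ℕ} (w : Fin (m + 1) → ℕ) :
    Set (PW F w) :=
  {c | ∃ x : {v : Fin (m + 1) → AlgebraicClosure F // v ≠ 0},
    PW.mk F w x = c ∧
    ∃ h : (fun i => x.1 i ^ Fintype.card F) ≠ (0 : Fin (m + 1) → AlgebraicClosure F),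
      PW.mk F w ⟨fun i => x.1 i ^ Fintype.card F, h⟩ = c}

/-- `V_{ℙ(w)}(f)(𝔽_q)`: the rational points at which `f` vanishes. -/
def vanishSet (F : Type) [Field F] [Fintype F] {m : ℕ} (w : Fin (m + 1) → ℕ)
    (f : MvPolynomial (Fin (m + 1)) F) : Set (PW F w) :=
  {c | c ∈ ratPts F w ∧ ∀ x, PW.mk F w x = c →
    MvPolynomial.eval x.1 (MvPolynomial.map (algebraMap F (AlgebraicClosure F)) f) = 0}

/-- `e_q(d; w)`: the maximal number of rational zeroes of a nonzero
weighted homogeneous polynomial of degree `d`. -/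
def eMax (F : Type) [Field F] [Fintype F] {m : ℕ} (w : Fin (m + 1) → ℕ) (d : ℕ) : ℕ :=
  sSup {n | ∃ f : MvPolynomial (Fin (m + 1)) F,
    f ≠ 0 ∧ MvPolynomial.IsWeightedHomogeneous w f d ∧ n = (vanishSet F w f).ncard}

/-- weighted degree of a monomial (exponent vector). -/
def wdeg {m : ℕ} (w : Fin (m + 1) → ℕ) (a : Fin (m + 1) →₀ ℕ) : ℕ := ∑ i, w i * a i

/-- degree-lexicographic order (weighted degree first, `x_0 < x_1 < ⋯ < x_m`). -/
def dlexLt {m : ℕ} (w : Fin (m + 1) → ℕ) (a b : Fin (m + 1) →₀ ℕ) : Prop :=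
  wdeg w a < wdeg w b ∨
    (wdeg w a = wdeg w b ∧ ∃ i, a i < b i ∧ ∀ j, i < j → a j = b j)

/-- `a` is the initial monomial of `f` for the weighted deglex order. -/
def IsInitial (F : Type) [Field F] {m : ℕ} (w : Fin (m + 1) → ℕ)
    (f : MvPolynomial (Fin (m + 1)) F) (a : Fin (m + 1) →₀ ℕ) : Prop :=
  a ∈ f.support ∧ ∀ b ∈ f.support, b ≠ a → dlexLt w b a

/-- The vanishing ideal `I(ℙ(w)(𝔽_q))`, generated by the homogeneous polynomials
vanishing at every rational point. -/
def vanishingIdeal (F : Type) [Field F] [Fintype F] {m : ℕ} (w : Fin (m + 1) → ℕ) :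
    Ideal (MvPolynomial (Fin (m + 1)) F) :=
  Ideal.span {g | (∃ e, MvPolynomial.IsWeightedHomogeneous w g e) ∧
    ∀ c ∈ ratPts F w, ∀ x, PW.mk F w x = c →
      MvPolynomial.eval x.1 (MvPolynomial.map (algebraMap F (AlgebraicClosure F)) g) = 0}

/-- `M̄`: monomials divisible by no initial monomial of a nonzero homogeneous
element of the vanishing ideal. -/
def Mbar (F : Type) [Field F] [Fintype F] {m : ℕ} (w : Fin (m + 1) → ℕ) :
    Set (Fin (m + 1) →₀ ℕ) :=
  {a | ¬ ∃ g : MvPolynomial (Fin (m + 1)) F, g ≠ 0 ∧ g ∈ vanishingIdeal F w ∧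
    (∃ e, MvPolynomial.IsWeightedHomogeneous w g e) ∧ ∃ b, IsInitial F w g b ∧ b ≤ a}

/-- `M̄_d`. -/
def MbarD (F : Type) [Field F] [Fintype F] {m : ℕ} (w : Fin (m + 1) → ℕ) (d : ℕ) :
    Set (Fin (m + 1) →₀ ℕ) :=
  {a ∈ Mbar F w | wdeg w a = d}

/-- `M̄_{d,i}`. -/
def MbarDI (F : Type) [Field F] [Fintype F] {m : ℕ} (w : Fin (m + 1) → ℕ) (d : ℕ)
    (i : Fin (m + 1)) : Set (Fin (m + 1) →₀ ℕ) :=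
  {a ∈ MbarD F w d | (∀ t, t < i → a t = 0) ∧ 1 ≤ a i}

/-- The regularity set `reg(ℙ(w)(𝔽_q)) = {d ≥ 1 : |M̄_d| = p_m}`. -/
def regSet (F : Type) [Field F] [Fintype F] {m : ℕ} (w : Fin (m + 1) → ℕ) : Set ℕ :=
  {d | 1 ≤ d ∧ (MbarD F w d).ncard = pSum (Fintype.card F) (m + 1)}

/-- Footprint bound at level `dtil`: number of monomials of `M̄_{dtil}` divisible by `a`. -/
def FB (F : Type) [Field F] [Fintype F] {m : ℕ} (w : Fin (m + 1) → ℕ) (dtil : ℕ)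
    (a : Fin (m + 1) →₀ ℕ) : ℕ :=
  {b | b ∈ MbarD F w dtil ∧ a ≤ b}.ncard

/-- `FB_i`: number of monomials of `M̄_{dtil, i}` divisible by `a`. -/
def FBi (F : Type) [Field F] [Fintype F] {m : ℕ} (w : Fin (m + 1) → ℕ) (dtil : ℕ)
    (i : Fin (m + 1)) (a : Fin (m + 1) →₀ ℕ) : ℕ :=
  {b | b ∈ MbarDI F w dtil i ∧ a ≤ b}.ncard

/-- Hilbert function of `𝔽_q[x]/I(ℙ(w)(𝔽_q))` at degree `d`. -/
def hilb (F : Type) [Field F] [Fintype F] {m : ℕ} (w : Fin (m + 1) → ℕ) (d : ℕ) : ℕ :=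
  Module.finrank F
    (↥(weightedHomogeneousSubmodule F w d) ⧸
      (Submodule.comap (weightedHomogeneousSubmodule F w d).subtype
        (Submodule.restrictScalars F (vanishingIdeal F w))))

/-- Denumerant: the number of representations `d = w0*i0 + w1*i1`. -/
def den (w0 w1 d : ℕ) : ℕ := {p : ℕ × ℕ | w0 * p.1 + w1 * p.2 = d}.ncard


/-- number of non-zeroes -/
def nnz {F : Type} [Field F] {n : ℕ} (G : MvPolynomial (Fin n) F) : ℕ :=
  Nat.card {v : Fin n → F // eval v G ≠ 0}

lemma exists_linEquiv_aux {F : Type} [Field F] {n : ℕ} (P : Fin (n + 1) → F) (hP : P ≠ 0) :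
    ∃ e : (Fin (n + 1) → F) ≃ₗ[F] (Fin (n + 1) → F), e (Pi.single 0 1) = P := by
  obtain ⟨j, hj⟩ := Function.ne_iff.mp hP
  let L : (Fin (n + 1) → F) →ₗ[F] (Fin (n + 1) → F) :=
    LinearMap.funLeft F F (Equiv.swap 0 j) +
      (LinearMap.proj 0).smulRight (P - Pi.single j 1)
  have hL : ∀ y i, L y i = y (Equiv.swap 0 j i) + y 0 * (P i - (Pi.single j 1 : Fin (n+1) → F) i) := by
    intro y i
    simp [L, LinearMap.funLeft_apply]
  have hinj : Function.Injective L := by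
    rw [← LinearMap.ker_eq_bot, LinearMap.ker_eq_bot']
    intro y hy
    have h0 : y 0 = 0 := by
      have := congrFun hy j
      rw [hL] at this
      simp at this
      have h2 : y 0 * P j = 0 := by linear_combination this
      exact (mul_eq_zero.mp h2).resolve_right hj
    funext i
    have := congrFun hy (Equiv.swap 0 j i)
    rw [hL] at this
    simpa [h0] using this
  refine ⟨LinearEquiv.ofInjectiveEndo L hinj, ?_⟩
  funext i
  rw [LinearEquiv.coe_ofInjectiveEndo, hL]
  by_cases hi : i = j
  · subst hi; simp
  · have : Equiv.swap 0 j i ≠ 0 := by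
      intro h
      apply hi
      have := congrArg (Equiv.swap 0 j) h
      simpa using this
    simp [this, hi]

lemma nnz_linEquiv {F : Type} [Field F] {n s : ℕ} (G : MvPolynomial (Fin n) F)
    (hG : G.IsHomogeneous s) (e : (Fin n → F) ≃ₗ[F] (Fin n → F)) :
    ∃ G' : MvPolynomial (Fin n) F, G'.IsHomogeneous s ∧ ∀ v, eval v G' = eval (e v) G := by
  refine ⟨aeval (fun i => ∑ j, C (e (Pi.single j 1) i) * X j) G, ?_, ?_⟩
  · have := hG.aeval (fun i => ∑ j, C (e (Pi.single j 1) i) * (X j : MvPolynomial (Fin n) F))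
      (n := 1) (by
        intro i
        apply IsHomogeneous.sum
        intro j _
        simpa using (isHomogeneous_C _ _).mul (isHomogeneous_X F j))
    simpa using this
  · intro v
    have h : e v = fun i => ∑ j, e (Pi.single j 1) i * v j := by
      funext i
      have h1 : v = ∑ j, v j • (Pi.single j 1 : Fin n → F) := by
        funext t
        simp [Finset.sum_apply, Pi.single_apply]
      conv_lhs => rw [h1, map_sum]
      simp [Finset.sum_apply, mul_comm]
    rw [h]
    rw [← coe_aeval_eq_eval, ← coe_aeval_eq_eval]
    simp only [RingHom.coe_coe]
    rw [← AlgHom.comp_apply, comp_aeval]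
    simp

/-- if `G` vanishes at `e_0`, then its degree in `x_0` is less than `s` -/
lemma natDegree_lt_aux {F : Type} [Field F] {n s : ℕ} (G : MvPolynomial (Fin (n+1)) F)
    (hG : G.IsHomogeneous s) (hG0 : G ≠ 0)
    (h0 : eval (Pi.single 0 1 : Fin (n+1) → F) G = 0) :
    (finSuccEquiv F n G).natDegree < s := by
  have hle : (finSuccEquiv F n G).natDegree ≤ s := by
    rw [natDegree_finSuccEquiv]
    exact (degreeOf_le_totalDegree _ _).trans hG.totalDegree_le
  refine lt_of_le_of_ne hle ?_
  intro heq
  have hc : (finSuccEquiv F n G).coeff s ≠ 0 := by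
    rw [← heq]
    simpa using hG0
  have hh := hG.finSuccEquiv_coeff_isHomogeneous s 0 (by simp)
  have hC := totalDegree_eq_zero_iff_eq_C.mp (Nat.le_zero.mp hh.totalDegree_le)
  have h1 : (Pi.single 0 1 : Fin (n+1) → F) = Fin.cons 1 0 := by
    funext i
    refine Fin.cases ?_ ?_ i <;> simp
  rw [h1, eval_eq_eval_mv_eval', Polynomial.eval_map, Polynomial.eval₂_eq_sum_range, heq,
    Finset.sum_range_succ, Finset.sum_eq_zero] at h0
  · rw [hC] at h0
    simp at h0
    apply hc
    rw [hC, h0, map_zero]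
  · intro i hi
    rw [Finset.mem_range] at hi
    have := hG.finSuccEquiv_coeff_isHomogeneous i (s - i) (by omega)
    have h3 : eval (0 : Fin n → F) ((finSuccEquiv F n G).coeff i) = 0 := by
      have h4 := this.coeff_eq_zero (d := 0) (by simp; omega)
      rwa [← constantCoeff_eq, ← eval_zero] at h4
    rw [h3, zero_mul]

/-- main step: fibre over the nonzeros of the leading coefficient -/
lemma nnz_step {F : Type} [Field F] [Fintype F] {n : ℕ} (G : MvPolynomial (Fin (n+1)) F) (k : ℕ)
    (hk : (finSuccEquiv F n G).natDegree = k) :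
    (Fintype.card F - k) * nnz ((finSuccEquiv F n G).coeff k) ≤ nnz G := by
  classical
  unfold nnz
  have hfib : ∀ v : {v : Fin n → F // eval v ((finSuccEquiv F n G).coeff k) ≠ 0},
      Fintype.card F - k ≤ Nat.card {y : F // eval (Fin.cons y v.1 : Fin (n+1) → F) G ≠ 0} := by
    intro v
    set p := Polynomial.map (eval v.1) (finSuccEquiv F n G) with hp
    have hp0 : p ≠ 0 := by
      intro h
      apply v.2
      have := congrArg (fun r => Polynomial.coeff r k) h
      simpa [hp, Polynomial.coeff_map] using this
    have hdeg : p.natDegree ≤ k := hk ▸ Polynomial.natDegree_map_le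
    have h1 : (Finset.univ.filter fun y : F => p.eval y = 0).card ≤ k := by
      refine le_trans ?_ ((Polynomial.card_roots' p).trans hdeg)
      refine le_trans (Finset.card_le_card ?_) (Multiset.toFinset_card_le _)
      intro y hy
      simp at hy
      simp [hp0, hy]
    have h2 := Finset.card_filter_add_card_filter_not (s := (Finset.univ : Finset F))
      (fun y : F => p.eval y = 0)
    rw [Nat.card_eq_fintype_card, Fintype.card_subtype]
    simp only [eval_eq_eval_mv_eval']
    rw [Finset.card_univ] at h2
    simp only [← hp, ne_eq]
    omega
  have hinj : Nat.card (Σ v : {v : Fin n → F // eval v ((finSuccEquiv F n G).coeff k) ≠ 0},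
      {y : F // eval (Fin.cons y v.1 : Fin (n+1) → F) G ≠ 0}) ≤
      Nat.card {v : Fin (n+1) → F // eval v G ≠ 0} := by
    apply Nat.card_le_card_of_injective (fun z => ⟨Fin.cons z.2.1 z.1.1, z.2.2⟩)
    rintro ⟨⟨v, hv⟩, ⟨y, hy⟩⟩ ⟨⟨v', hv'⟩, ⟨y', hy'⟩⟩ h
    simp only [Subtype.mk.injEq] at h
    obtain ⟨rfl, rfl⟩ := Fin.cons_inj.mp h
    rfl
  refine le_trans ?_ hinj
  rw [Nat.card_sigma, mul_comm]
  calc _ = ∑ v : {v : Fin n → F // eval v ((finSuccEquiv F n G).coeff k) ≠ 0},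
        (Fintype.card F - k) := by simp
    _ ≤ _ := Finset.sum_le_sum fun v _ => hfib v

lemma serre_arith (q s k : ℕ) (hs : s ≤ q) (hkle : k ≤ s) (hk : k < s ∨ k = 0) :
    q * (q + 1 - s) ≤ (q - k) * (q + 1 - (s - k)) := by
  obtain ⟨r, rfl⟩ := Nat.exists_eq_add_of_le hs
  obtain ⟨t, rfl⟩ := Nat.exists_eq_add_of_le hkle
  have e1 : k + t + r + 1 - (k + t) = r + 1 := by omega
  have e2 : k + t + r - k = t + r := by omega
  have e3 : k + t + r + 1 - (k + t - k) = k + r + 1 := by omega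
  rw [e1, e2, e3]
  rcases hk with hk | hk
  · obtain ⟨u, rfl⟩ : ∃ u, t = u + 1 := ⟨t - 1, by omega⟩
    nlinarith [Nat.zero_le (k * u)]
  · subst hk; nlinarith

lemma serre {F : Type} [Field F] [Fintype F] (n : ℕ) : ∀ (s : ℕ) (_ : s ≤ Fintype.card F)
    (G : MvPolynomial (Fin n) F) (_ : G.IsHomogeneous s) (_ : G ≠ 0),
    (Fintype.card F - 1) * (Fintype.card F + 1 - s) * Fintype.card F ^ n
      ≤ Fintype.card F ^ 2 * nnz G := by
  have hq : 1 < Fintype.card F := Fintype.one_lt_card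
  set q := Fintype.card F with hqd
  induction n with
  | zero =>
    intro s hs G hG hG0
    obtain ⟨v, hv⟩ : ∃ v, eval v G ≠ 0 := by
      by_contra hcon
      push Not at hcon
      exact hG0 (hG.eq_zero_of_forall_eval_eq_zero_of_le_card hcon (by simpa [hqd] using hs))
    have : 1 ≤ nnz G := by
      have : Nonempty {v : Fin 0 → F // eval v G ≠ 0} := ⟨⟨v, hv⟩⟩
      exact Nat.card_pos
    obtain ⟨r, hr⟩ : ∃ r, q = r + 1 := ⟨q - 1, by omega⟩
    calc (q - 1) * (q + 1 - s) * q ^ 0 ≤ (q - 1) * (q + 1) := by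
          simp; exact Nat.mul_le_mul_left _ (by omega)
      _ ≤ q ^ 2 * 1 := by rw [hr]; simp; nlinarith
      _ ≤ _ := Nat.mul_le_mul_left _ this
  | succ n ih =>
    -- main case
    have main : ∀ (s : ℕ) (_ : s ≤ q) (G : MvPolynomial (Fin (n+1)) F) (_ : G.IsHomogeneous s)
        (_ : G ≠ 0) (_ : (finSuccEquiv F n G).natDegree < s ∨
          (finSuccEquiv F n G).natDegree = 0),
        (q - 1) * (q + 1 - s) * q ^ (n + 1) ≤ q ^ 2 * nnz G := by
      intro s hs G hG hG0 hk
      have hkle : (finSuccEquiv F n G).natDegree ≤ s := by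
        rw [natDegree_finSuccEquiv]
        exact (degreeOf_le_totalDegree _ _).trans hG.totalDegree_le
      obtain ⟨k, hkd⟩ : ∃ k, k = (finSuccEquiv F n G).natDegree := ⟨_, rfl⟩
      rw [← hkd] at hk hkle
      have h1 := nnz_step G k hkd.symm
      have hc : (finSuccEquiv F n G).coeff k ≠ 0 := by
        rw [hkd]
        simpa using hG0
      have h2 := ih (s - k) (by omega) _
        (hG.finSuccEquiv_coeff_isHomogeneous k (s - k) (by omega)) hc
      have h3 : q * (q + 1 - s) ≤ (q - k) * (q + 1 - (s - k)) := by
        exact serre_arith q s k hs hkle hk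
      calc (q - 1) * (q + 1 - s) * q ^ (n + 1) = (q - 1) * (q * (q + 1 - s)) * q ^ n := by ring
        _ ≤ (q - 1) * ((q - k) * (q + 1 - (s - k))) * q ^ n := by gcongr
        _ = (q - k) * ((q - 1) * (q + 1 - (s - k)) * q ^ n) := by ring
        _ ≤ (q - k) * (q ^ 2 * nnz ((finSuccEquiv F n G).coeff k)) := by gcongr
        _ = q ^ 2 * ((q - k) * nnz ((finSuccEquiv F n G).coeff k)) := by ring
        _ ≤ _ := by gcongr
    intro s hs G hG hG0
    rcases Nat.eq_zero_or_pos s with rfl | hs1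
    · apply main 0 hs G hG hG0
      right
      rw [natDegree_finSuccEquiv]
      exact Nat.le_zero.mp ((degreeOf_le_totalDegree _ _).trans hG.totalDegree_le)
    by_cases hP : ∃ P : Fin (n+1) → F, P ≠ 0 ∧ eval P G = 0
    · obtain ⟨P, hP0, hP⟩ := hP
      obtain ⟨e, he⟩ := exists_linEquiv_aux P hP0
      obtain ⟨G', hG', hev⟩ := nnz_linEquiv G hG e
      have hn : nnz G' = nnz G := by
        unfold nnz
        apply Nat.card_congr
        refine e.toEquiv.subtypeEquiv ?_
        intro v
        rw [hev]
        rfl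
      obtain ⟨v, hv⟩ : ∃ v, eval v G ≠ 0 := by
        by_contra hcon
        push Not at hcon
        exact hG0 (hG.eq_zero_of_forall_eval_eq_zero_of_le_card hcon (by simpa [hqd] using hs))
      have hG'0 : G' ≠ 0 := by
        rintro rfl
        have := hev (e.symm v)
        simp at this
        exact hv this.symm
      rw [← hn]
      exact main s hs G' hG' hG'0 (Or.inl (natDegree_lt_aux G' hG' hG'0 (by rw [hev, he, hP])))
    · push Not at hP
      have hn : q ^ (n + 1) ≤ nnz G + 1 := by
        classical
        have h1 : Nat.card {v : Fin (n+1) → F // v ≠ 0} ≤ nnz G := by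
          apply Nat.card_le_card_of_injective (fun v => ⟨v.1, hP v.1 v.2⟩)
          intro a b h
          simpa [Subtype.ext_iff] using h
        rw [Nat.card_eq_fintype_card, Fintype.card_subtype_compl] at h1
        simp at h1
        exact h1
      obtain ⟨r, hr⟩ := Nat.exists_eq_add_of_le hs
      have e1 : q + 1 - s = r + 1 := by omega
      rw [e1]
      obtain ⟨p, hp⟩ : ∃ p, q = p + 1 := ⟨q - 1, by omega⟩
      have e2 : q - 1 = p := by omega
      rw [e2]
      have hqp : q ≤ q ^ (n + 1) := Nat.le_self_pow (by omega) q
      have h5 : q ^ 2 * q ^ (n+1) ≤ q ^ 2 * nnz G + q ^ 2 := by nlinarith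
      have h6 : q ^ 2 ≤ q * q ^ (n+1) := by nlinarith
      have h7 : p * (r + 1) + q ≤ q ^ 2 := by
        have : r ≤ p := by omega
        rw [hp]; nlinarith
      nlinarith

lemma mem_range_of_pow_card (F : Type) [Field F] [Fintype F] (y : AlgebraicClosure F)
    (hy : y ^ Fintype.card F = y) : ∃ x : F, algebraMap F (AlgebraicClosure F) x = y := by
  classical
  let K := AlgebraicClosure F
  have hne : (Polynomial.X ^ Fintype.card F - Polynomial.X : Polynomial K) ≠ 0 :=
    FiniteField.X_pow_card_sub_X_ne_zero K Fintype.one_lt_card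
  have hsub : Finset.univ.image (algebraMap F K) ⊆
      (Polynomial.X ^ Fintype.card F - Polynomial.X : Polynomial K).roots.toFinset := by
    intro z hz
    obtain ⟨x, -, rfl⟩ := Finset.mem_image.mp hz
    rw [Multiset.mem_toFinset, Polynomial.mem_roots hne]
    simp only [Polynomial.IsRoot, Polynomial.eval_sub, Polynomial.eval_pow, Polynomial.eval_X]
    rw [← map_pow, FiniteField.pow_card, sub_self]
  have hcard : (Polynomial.X ^ Fintype.card F - Polynomial.X : Polynomial K).roots.toFinset.card ≤
      (Finset.univ.image (algebraMap F K)).card := by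
    rw [Finset.card_image_of_injective _ (algebraMap F K).injective, Finset.card_univ]
    refine (Multiset.toFinset_card_le _).trans ((Polynomial.card_roots' _).trans ?_)
    rw [FiniteField.X_pow_card_sub_X_natDegree_eq K Fintype.one_lt_card]
  have heq := Finset.eq_of_subset_of_card_le hsub hcard
  have hmem : y ∈ (Polynomial.X ^ Fintype.card F - Polynomial.X : Polynomial K).roots.toFinset := by
    rw [Multiset.mem_toFinset, Polynomial.mem_roots hne]
    simp only [Polynomial.IsRoot, Polynomial.eval_sub, Polynomial.eval_pow, Polynomial.eval_X]
    rw [hy, sub_self]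
  rw [← heq] at hmem
  obtain ⟨x, -, hx⟩ := Finset.mem_image.mp hmem
  exact ⟨x, hx⟩

lemma wRel_equivalence (F : Type) [Field F] {m : ℕ} (w : Fin (m + 1) → ℕ) :
    Equivalence (wRel F w) where
  refl x := ⟨1, by simp⟩
  symm := by
    rintro x y ⟨l, h⟩
    refine ⟨l⁻¹, fun i => ?_⟩
    rw [h i, ← mul_assoc, ← mul_pow]
    simp
  trans := by
    rintro x y z ⟨l, h⟩ ⟨k, h'⟩
    refine ⟨k * l, fun i => ?_⟩
    rw [h' i, h i, ← mul_assoc, ← mul_pow]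
    simp

lemma exists_rat_rep (F : Type) [Field F] [Fintype F] {m : ℕ} (w : Fin (m + 1) → ℕ)
    (c : PW F w) (hc : c ∈ ratPts F w) :
    ∃ (x : Fin (m + 1) → F) (h : (fun i => algebraMap F (AlgebraicClosure F) (x i)) ≠ 0),
      PW.mk F w ⟨_, h⟩ = c := by
  obtain ⟨x, hx, h, hx'⟩ := hc
  have hrel : wRel F w x ⟨fun i => x.1 i ^ Fintype.card F, h⟩ := by
    rw [← (wRel_equivalence F w).quot_mk_eq_iff]
    exact hx.trans hx'.symm
  obtain ⟨l, hl⟩ := hrel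
  have hq : 1 < Fintype.card F := Fintype.one_lt_card
  obtain ⟨u, hu⟩ := IsAlgClosed.exists_pow_nat_eq ((l⁻¹ : (AlgebraicClosure F)ˣ) : AlgebraicClosure F)
    (n := Fintype.card F - 1) (by omega)
  have hu0 : u ≠ 0 := by
    rintro rfl
    rw [zero_pow (by omega)] at hu
    exact (Units.ne_zero _) hu.symm
  have hfix : ∀ i, (u ^ w i * x.1 i) ^ Fintype.card F = u ^ w i * x.1 i := by
    intro i
    have h1 := hl i
    simp only at h1
    have h2 : u ^ Fintype.card F * (l : AlgebraicClosure F) = u := by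
      rw [← Nat.sub_add_cancel hq.le, pow_succ, hu]
      have : ((l⁻¹ : (AlgebraicClosure F)ˣ) : AlgebraicClosure F) * l = 1 := by simp
      linear_combination u * this
    calc (u ^ w i * x.1 i) ^ Fintype.card F = (u ^ Fintype.card F) ^ w i * x.1 i ^ Fintype.card F := by
          rw [mul_pow, ← pow_mul, ← pow_mul, mul_comm (w i)]
      _ = (u ^ Fintype.card F * l) ^ w i * x.1 i := by rw [h1, mul_pow]; ring
      _ = _ := by rw [h2]
  choose y hy using fun i => mem_range_of_pow_card F _ (hfix i)
  have hne : (fun i => algebraMap F (AlgebraicClosure F) (y i)) ≠ 0 := by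
    obtain ⟨j, hj⟩ := Function.ne_iff.mp x.2
    intro h0
    have := congrFun h0 j
    simp only [hy j, Pi.zero_apply] at this
    exact (mul_ne_zero (pow_ne_zero _ hu0) hj) this
  refine ⟨y, hne, ?_⟩
  rw [← hx]
  symm
  apply Quot.sound
  exact ⟨Units.mk0 u hu0, fun i => by simp [hy i]⟩

/-- every zero class has at least `q-1` rational representatives -/
lemma ncard_vanish_le (F : Type) [Field F] [Fintype F] {m : ℕ} (w : Fin (m + 1) → ℕ)
    (hpos : ∀ i, 1 ≤ w i) (f : MvPolynomial (Fin (m + 1)) F) :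
    (vanishSet F w f).ncard * (Fintype.card F - 1) ≤
      Nat.card {x : Fin (m + 1) → F // x ≠ 0 ∧ eval x f = 0} := by
  classical
  choose x hx hxc using fun c : vanishSet F w f => exists_rat_rep F w c.1 c.2.1
  let g : vanishSet F w f → ℕ := fun c => (Finset.univ.filter fun i => x c i ≠ 0).gcd w
  have hgdvd : ∀ c i, x c i ≠ 0 → g c ∣ w i := fun c i hi =>
    Finset.gcd_dvd (by simpa using hi)
  have hgpos : ∀ c, 0 < g c := by
    intro c
    obtain ⟨j, hj⟩ := Function.ne_iff.mp (hx c)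
    have hj' : x c j ≠ 0 := by
      intro h; simp [h] at hj
    exact Nat.pos_of_dvd_of_pos (hgdvd c j hj') (hpos j)
  let φ : vanishSet F w f × Fˣ → (Fin (m + 1) → F) :=
    fun z i => (z.2 : F) ^ (w i / g z.1) * x z.1 i
  have hφne : ∀ z, (fun i => algebraMap F (AlgebraicClosure F) (φ z i)) ≠ 0 := by
    intro z h0
    apply hx z.1
    funext i
    have := congrFun h0 i
    simp only [φ, map_mul, map_pow, Pi.zero_apply] at this
    rcases mul_eq_zero.mp this with h | h
    · exfalso
      exact pow_ne_zero _ (by simp) h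
    · simpa using h
  have hφc : ∀ z, PW.mk F w ⟨_, hφne z⟩ = z.1.1 := by
    intro z
    rw [← hxc z.1]
    symm
    apply Quot.sound
    obtain ⟨u, hu⟩ := IsAlgClosed.exists_pow_nat_eq
      (algebraMap F (AlgebraicClosure F) (z.2 : F)) (hgpos z.1)
    have hu0 : u ≠ 0 := by
      rintro rfl
      rw [zero_pow (hgpos z.1).ne'] at hu
      have : algebraMap F (AlgebraicClosure F) (z.2 : F) ≠ 0 := by simp
      exact this hu.symm
    refine ⟨Units.mk0 u hu0, fun i => ?_⟩
    simp only [φ, map_mul, map_pow, Units.val_mk0]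
    by_cases hi : x z.1 i = 0
    · simp [hi]
    · rw [← hu, ← pow_mul, Nat.mul_div_cancel' (hgdvd _ _ hi)]
  have hφ0 : ∀ z, φ z ≠ 0 ∧ eval (φ z) f = 0 := by
    intro z
    constructor
    · intro h
      apply hφne z
      funext i
      simp [h]
    · have := z.1.2.2 _ (hφc z)
      simp only [eval_map] at this
      apply (algebraMap F (AlgebraicClosure F)).injective
      rw [map_zero, ← this]
      exact (eval₂_comp (algebraMap F (AlgebraicClosure F)) (φ z) f)
  have hinj : Function.Injective (fun z => (⟨φ z, hφ0 z⟩ :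
      {x : Fin (m + 1) → F // x ≠ 0 ∧ eval x f = 0})) := by
    rintro ⟨c, t⟩ ⟨c', t'⟩ h
    simp only [Subtype.mk.injEq] at h
    have hcc : c = c' := by
      apply Subtype.ext
      rw [← hφc (c, t), ← hφc (c', t')]
      congr 1
      apply Subtype.ext
      simp only [h]
    subst hcc
    have hu : t / t' = 1 := by
      rw [← orderOf_eq_one_iff]
      have hd : orderOf (t / t') * g c ∣ g c := by
        apply Finset.dvd_gcd
        intro i hi
        have hi' : x c i ≠ 0 := by simpa using hi
        have h1 := congrFun h i
        simp only [φ] at h1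
        have h2 := mul_right_cancel₀ hi' h1
        have h3 : (t / t') ^ (w i / g c) = 1 := by
          rw [div_pow, div_eq_one]
          ext
          simpa using h2
        have h4 := orderOf_dvd_of_pow_eq_one h3
        obtain ⟨k, hk⟩ := h4
        refine ⟨k, ?_⟩
        rw [← Nat.div_mul_cancel (hgdvd c i hi'), hk]
        ring
      have := Nat.le_of_dvd (hgpos c) hd
      have h5 : orderOf (t / t') ≤ 1 := by
        by_contra hcon
        have := hgpos c
        nlinarith
      have := orderOf_pos (t / t')
      omega
    rw [div_eq_one] at hu
    rw [hu]
  have := Nat.card_le_card_of_injective _ hinj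
  rw [Nat.card_prod, Nat.card_eq_fintype_card (α := Fˣ), Fintype.card_units] at this
  exact this

/-- the final count of affine zeroes -/
lemma final_arith (q m s N V : ℕ) (hq : 1 < q) (hm : 1 ≤ m)
    (hV : V * (q - 1) ≤ N)
    (hN : N + 1 ≤ ((q - 1) * s + 1) * q ^ (m - 1)) :
    V ≤ s * q ^ (m - 1) + pSum q (m - 1) := by
  have hp : pSum q (m - 1) * (q - 1) + 1 = q ^ (m - 1) := by
    unfold pSum
    have := geom_sum_mul_add (q - 1) (m - 1)
    rwa [Nat.sub_add_cancel hq.le] at this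
  have h1 : V * (q - 1) ≤ (s * q ^ (m - 1) + pSum q (m - 1)) * (q - 1) := by
    nlinarith
  exact Nat.le_of_mul_le_mul_right h1 (by omega)

lemma count_aux {F : Type} [Field F] [Fintype F] {n : ℕ} (f : MvPolynomial (Fin n) F)
    (h0 : eval (0 : Fin n → F) f = 0) :
    Nat.card {x : Fin n → F // x ≠ 0 ∧ eval x f = 0} + 1 + nnz f ≤ Fintype.card F ^ n := by
  classical
  unfold nnz
  simp only [Nat.card_eq_fintype_card, Fintype.card_subtype]
  have h1 := Finset.card_filter_add_card_filter_not (s := (Finset.univ : Finset (Fin n → F)))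
    (fun y => eval y f = 0)
  rw [Finset.card_univ, Fintype.card_fun, Fintype.card_fin] at h1
  have h2 : (Finset.univ.filter fun x : Fin n → F => x ≠ 0 ∧ eval x f = 0)
      = (Finset.univ.filter fun x : Fin n → F => eval x f = 0).erase 0 := by
    ext x; simp
  have h3 : (0 : Fin n → F) ∈ Finset.univ.filter fun x : Fin n → F => eval x f = 0 := by
    simp only [Finset.mem_filter, Finset.mem_univ, true_and]
    exact h0
  rw [h2, Finset.card_erase_add_one h3, ← h1]

/-- Replace `x_0^W` by `x_0`. -/
lemma exists_homog {F : Type} [Field F] [Fintype F] {m : ℕ} (f : MvPolynomial (Fin (m + 1)) F)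
    (W s : ℕ) (hW : 1 ≤ W)
    (hdeg : ∀ b ∈ f.support, b 0 + W * ∑ i : Fin m, b i.succ = W * s)
    (a : Fin (m + 1) →₀ ℕ) (ha : a ∈ f.support) (ha0 : a 0 = 0) :
    ∃ G : MvPolynomial (Fin (m + 1)) F, G.IsHomogeneous s ∧ G ≠ 0 ∧ nnz G ≤ nnz f := by
  classical
  have hb0 : ∀ b ∈ f.support, ∃ e, b 0 = W * e ∧ e + ∑ i : Fin m, b i.succ = s := by
    intro b hb
    have h1 := hdeg b hb
    have h2 : W ∣ b 0 := by
      rw [← Nat.dvd_add_left (Dvd.intro _ rfl), h1]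
      exact Dvd.intro _ rfl
    obtain ⟨e, he⟩ := h2
    refine ⟨e, he, ?_⟩
    rw [he, ← mul_add] at h1
    exact Nat.eq_of_mul_eq_mul_left hW h1
  let r : (Fin (m + 1) →₀ ℕ) → (Fin (m + 1) →₀ ℕ) :=
    fun b => Finsupp.cons (b 0 / W) (Finsupp.tail b)
  have hr0 : ∀ b, r b 0 = b 0 / W := fun b => by simp [r]
  have hrs : ∀ b (i : Fin m), r b i.succ = b i.succ := fun b i => by simp [r, Finsupp.tail_apply]
  let G : MvPolynomial (Fin (m + 1)) F := ∑ b ∈ f.support, monomial (r b) (coeff b f)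
  have hGev : ∀ x : Fin (m + 1) → F, eval x G =
      ∑ b ∈ f.support, coeff b f * (x 0 ^ (b 0 / W) * ∏ i : Fin m, x i.succ ^ b i.succ) := by
    intro x
    simp only [G, map_sum]
    apply Finset.sum_congr rfl
    intro b _
    rw [eval_monomial, Finsupp.prod_fintype _ _ (by simp), Fin.prod_univ_succ]
    simp only [hr0, hrs]
  have hfev : ∀ x : Fin (m + 1) → F, eval x f =
      ∑ b ∈ f.support, coeff b f * (x 0 ^ b 0 * ∏ i : Fin m, x i.succ ^ b i.succ) := by
    intro x
    rw [eval_eq']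
    simp only [Fin.prod_univ_succ]
  refine ⟨G, ?_, ?_, ?_⟩
  · apply IsHomogeneous.sum
    intro b hb
    apply isHomogeneous_monomial
    obtain ⟨e, he, hes⟩ := hb0 b hb
    rw [Finsupp.degree_eq_sum, Fin.sum_univ_succ]
    simp only [hr0, hrs]
    rw [he, Nat.mul_div_cancel_left _ hW, hes]
  · intro h
    have h1 : coeff a G = coeff a f := by
      simp only [G, coeff_sum, coeff_monomial]
      rw [Finset.sum_eq_single a]
      · rw [if_pos]
        ext i
        refine Fin.cases ?_ ?_ i
        · rw [hr0, ha0, Nat.zero_div]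
        · intro i; rw [hrs]
      · intro b hb hba
        rw [if_neg]
        intro hra
        apply hba
        ext i
        refine Fin.cases ?_ ?_ i
        · have := hr0 b
          rw [hra, ha0] at this
          obtain ⟨e, he, -⟩ := hb0 b hb
          rw [he, Nat.mul_div_cancel_left _ hW] at this
          rw [he, ← this, ha0, mul_zero]
        · intro i; rw [← hrs, hra]
      · intro h; exact absurd ha h
    rw [h, coeff_zero] at h1
    exact (mem_support_iff.mp ha) h1.symm
  · obtain ⟨V, rfl⟩ : ∃ V, W = V + 1 := ⟨W - 1, by omega⟩
    let φ : (Fin (m + 1) → F) → (Fin (m + 1) → F) := fun x =>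
      if x 0 = 0 then x else Fin.cons (x 0) (fun i => x 0 ^ V * x i.succ)
    have hφ0 : ∀ x, φ x 0 = x 0 := by
      intro x; simp only [φ]; split_ifs <;> simp
    have hinj : Function.Injective φ := by
      intro x y hxy
      have h0 : x 0 = y 0 := by rw [← hφ0 x, hxy, hφ0 y]
      by_cases hx : x 0 = 0
      · simpa [φ, hx, ← h0] using hxy
      · have hy : y 0 ≠ 0 := h0 ▸ hx
        funext i
        refine Fin.cases h0 (fun i => ?_) i
        have := congrFun hxy i.succ
        simp only [φ, if_neg hx, if_neg hy, Fin.cons_succ, ← h0] at this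
        exact mul_left_cancel₀ (pow_ne_zero _ hx) this
    have hφ : ∀ x, eval x G ≠ 0 → eval (φ x) f ≠ 0 := by
      intro x hx
      by_cases h0 : x 0 = 0
      · have : eval (φ x) f = eval x G := by
          rw [hGev, hfev]
          simp only [φ, if_pos h0]
          apply Finset.sum_congr rfl
          intro b hb
          obtain ⟨e, he, -⟩ := hb0 b hb
          rw [he, Nat.mul_div_cancel_left _ hW, h0]
          rcases Nat.eq_zero_or_pos e with rfl | hpos
          · simp
          · rw [zero_pow (by positivity), zero_pow (by omega)]
        rwa [this]
      · have : eval (φ x) f = x 0 ^ (V * s) * eval x G := by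
          rw [hGev, hfev, Finset.mul_sum]
          simp only [φ, if_neg h0, Fin.cons_zero, Fin.cons_succ]
          apply Finset.sum_congr rfl
          intro b hb
          obtain ⟨e, he, hes⟩ := hb0 b hb
          rw [he, Nat.mul_div_cancel_left _ hW]
          simp only [mul_pow]
          rw [Finset.prod_mul_distrib]
          simp only [← pow_mul]
          rw [Finset.prod_pow_eq_pow_sum, ← Finset.mul_sum]
          have : x 0 ^ ((V + 1) * e) * x 0 ^ (V * ∑ i : Fin m, b i.succ)
              = x 0 ^ (V * s) * x 0 ^ e := by
            rw [← pow_add, ← pow_add, ← hes]; congr 1; ring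
          linear_combination coeff b f * (∏ i : Fin m, x i.succ ^ b i.succ) * this
        rw [this]
        exact mul_ne_zero (pow_ne_zero _ h0) hx
    unfold nnz
    apply Nat.card_le_card_of_injective (fun x => ⟨φ x.1, hφ x.1 x.2⟩)
    intro x y hxy
    simp only [Subtype.mk.injEq] at hxy
    exact Subtype.ext (hinj hxy)

/-- Lemma 3.5 of the paper: bound on the number of rational zeroes of a
linear combination of monomials of `M̄_d` whose initial monomial only involves
the variables `x_1, …, x_ℓ` of weight `w_1`, when `w_1 ∣ d`. -/
theorem stmt10 (F : Type) [Field F] [Fintype F] (m ℓ : ℕ) (w : Fin (m + 1) → ℕ)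
    (hℓ1 : 1 ≤ ℓ) (hℓm : ℓ + 1 ≤ m)
    (hpos : ∀ i, 1 ≤ w i)
    (hw0 : w ⟨0, by omega⟩ = 1)
    (hweq : ∀ i : Fin (m + 1), 1 ≤ (i : ℕ) → (i : ℕ) ≤ ℓ → w i = w ⟨1, by omega⟩)
    (hlt : w ⟨ℓ, by omega⟩ < w ⟨ℓ + 1, by omega⟩)
    (hmono : ∀ i j : Fin (m + 1), ℓ + 1 ≤ (i : ℕ) → i ≤ j → w i ≤ w j)
    (d : ℕ) (hdvd : w ⟨1, by omega⟩ ∣ d)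
    (f : MvPolynomial (Fin (m + 1)) F) (hf0 : f ≠ 0)
    (hsupp : ∀ b ∈ f.support, b ∈ MbarD F w d)
    (a : Fin (m + 1) →₀ ℕ) (hain : IsInitial F w f a)
    (havars : ∀ j : Fin (m + 1), a j ≠ 0 → 1 ≤ (j : ℕ) ∧ (j : ℕ) ≤ ℓ) :
    (vanishSet F w f).ncard ≤
      (d / w ⟨1, by omega⟩) * Fintype.card F ^ (m - 1)
        + pSum (Fintype.card F) (m - 1) := by
  have hq : 1 < Fintype.card F := Fintype.one_lt_card
  obtain ⟨s, rfl⟩ := hdvd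
  set W := w ⟨1, by omega⟩ with hW
  have hW1 : 1 ≤ W := hpos _
  have hzero : (⟨0, by omega⟩ : Fin (m + 1)) = 0 := rfl
  rw [hzero] at hw0
  have hbl : ∀ b ∈ f.support, ∀ j : Fin (m + 1), ℓ < (j : ℕ) → b j = 0 := by
    intro b hb j hj
    have haj : a j = 0 := by
      by_contra hcon
      have := havars j hcon
      omega
    by_cases hba : b = a
    · rw [hba, haj]
    rcases hain.2 b hb hba with h | ⟨-, i, hi, hij⟩
    · rw [(hsupp b hb).2, (hsupp a hain.1).2] at h
      exact absurd h (lt_irrefl _)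
    · have h1 := havars i (by omega)
      rw [hij j (by rw [Fin.lt_def]; omega), haj]
  have hdeg : ∀ b ∈ f.support, b 0 + W * ∑ i : Fin m, b i.succ = W * s := by
    intro b hb
    rw [← (hsupp b hb).2, wdeg, Fin.sum_univ_succ, hw0, one_mul, Finset.mul_sum]
    congr 1
    apply Finset.sum_congr rfl
    intro i _
    by_cases hi : (i.succ : ℕ) ≤ ℓ
    · rw [hweq i.succ (by simp) hi]
    · rw [hbl b hb i.succ (by omega)]
      simp
  have ha0 : a 0 = 0 := by
    by_contra hcon
    have := (havars 0 hcon).1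
    simp at this
  obtain ⟨G, hG, hG0, hGf⟩ := exists_homog f W s hW1 hdeg a hain.1 ha0
  rw [Nat.mul_div_cancel_left _ hW1]
  have hV := ncard_vanish_le F w hpos f
  refine final_arith _ m s _ _ hq (by omega) hV ?_
  set q := Fintype.card F with hqd
  have htot : Nat.card {x : Fin (m + 1) → F // x ≠ 0 ∧ eval x f = 0} + 1 + nnz f ≤ q ^ (m + 1) ∨
      s = 0 ∧ Nat.card {x : Fin (m + 1) → F // x ≠ 0 ∧ eval x f = 0} = 0 := by
    rcases Nat.eq_zero_or_pos s with hs | hs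
    · right
      refine ⟨hs, ?_⟩
      have hfC : ∀ b ∈ f.support, b = 0 := by
        intro b hb
        have := hdeg b hb
        rw [hs, mul_zero, Nat.add_eq_zero_iff, Nat.mul_eq_zero] at this
        have h2 := this.2.resolve_left (by omega)
        rw [Finset.sum_eq_zero_iff] at h2
        ext i
        refine Fin.cases this.1 (fun i => h2 i (Finset.mem_univ _)) i
      have ha : a = 0 := hfC a hain.1
      have : IsEmpty {x : Fin (m + 1) → F // x ≠ 0 ∧ eval x f = 0} := by
        refine ⟨fun ⟨x, _, hx⟩ => ?_⟩
        rw [eval_eq', Finset.sum_eq_single a] at hx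
        · rw [ha] at hx
          have h3 := hain.1
          rw [mem_support_iff, ha] at h3
          simp at hx
          exact h3 hx
        · intro b hb hba
          exact absurd ((hfC b hb).trans ha.symm) hba
        · intro h; exact absurd hain.1 h
      exact Nat.card_of_isEmpty
    · left
      have h0 : eval (0 : Fin (m + 1) → F) f = 0 := by
        rw [eval_zero, constantCoeff_eq]
        by_contra hcon
        have := hdeg 0 (mem_support_iff.mpr hcon)
        simp at this
        omega
      exact count_aux f h0
  rcases htot with htot | ⟨hs, hN⟩
  · by_cases hs : s ≤ q
    · have h1 := serre (m + 1) s hs G hG hG0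
      have h2 : (q - 1) * (q + 1 - s) * q ^ (m - 1) ≤ nnz f := by
        refine le_trans ?_ hGf
        have e : q ^ (m + 1) = q ^ 2 * q ^ (m - 1) := by
          rw [← pow_add]; congr 1; omega
        rw [← hqd, e] at h1
        refine Nat.le_of_mul_le_mul_left ?_ (show 0 < q ^ 2 by positivity)
        calc _ = _ := by ring
          _ ≤ _ := h1
      have e : q ^ (m + 1) = q ^ 2 * q ^ (m - 1) := by
        rw [← pow_add]; congr 1; omega
      have h3 : (q - 1) * (q + 1 - s) + ((q - 1) * s + 1) = q ^ 2 := by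
        obtain ⟨r, hr⟩ := Nat.exists_eq_add_of_le hs
        have e1 : q + 1 - s = r + 1 := by omega
        obtain ⟨p, hp⟩ : ∃ p, q = p + 1 := ⟨q - 1, by omega⟩
        have e2 : q - 1 = p := by omega
        rw [e1, e2, hp]
        have : r + s = p + 1 := by omega
        nlinarith
      have h4 : (q - 1) * (q + 1 - s) * q ^ (m - 1) + ((q - 1) * s + 1) * q ^ (m - 1)
          = q ^ (m + 1) := by
        rw [e, ← h3]; ring
      omega
    · have e : q ^ (m + 1) = q ^ 2 * q ^ (m - 1) := by
        rw [← pow_add]; congr 1; omega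
      have h3 : q ^ 2 ≤ (q - 1) * s + 1 := by
        obtain ⟨p, hp⟩ : ∃ p, q = p + 1 := ⟨q - 1, by omega⟩
        have e2 : q - 1 = p := by omega
        rw [e2, hp]
        have : p + 2 ≤ s := by omega
        nlinarith
      have h4 : q ^ (m + 1) ≤ ((q - 1) * s + 1) * q ^ (m - 1) := by
        rw [e]; exact Nat.mul_le_mul_right _ h3
      omega
  · rw [hN, hs]
    simp
    exact Nat.one_le_pow _ _ (by omega)

end
end

section
/- Assume 1 = w_0 ≤ w_1 = ⋯ = w_ℓ and w_1 ∣ d. Let f ∈ 𝔽_q[x_0,…,x_m]^w_d be a nonzero weighted homogeneous polynomial that depends only on the variables x_0, x_1, …, x_ℓ and in which the exponent of x_0 in every monomial is divisible by w_1. Let f̃ ∈ 𝔽_q[y_0,…,y_ℓ] be the homogeneous polynomial of degree d/w_1 determined by f̃(x_0^{w_1}, x_1, …, x_ℓ) = f(x_0, …, x_ℓ). Then |V_{ℙ(w)}(f)(𝔽_q)| ≤ |V_{ℙ^ℓ}(f̃)(𝔽_q)| · q^{m−ℓ} + p_{m−ℓ−1}. -/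
open MvPolynomial

noncomputable section

lemma wRel_equiv (F : Type) [Field F] {m : ℕ} (w : Fin (m + 1) → ℕ) :
    Equivalence (wRel F w) := by
  refine ⟨fun x => ⟨1, by simp⟩, ?_, ?_⟩
  · rintro x y ⟨l, h⟩
    refine ⟨l⁻¹, fun i => ?_⟩
    rw [h i, ← mul_assoc, ← mul_pow]
    simp
  · rintro x y z ⟨l, h⟩ ⟨l', h'⟩
    refine ⟨l' * l, fun i => ?_⟩
    rw [h' i, h i, Units.val_mul, mul_pow, mul_assoc]

lemma PW_mk_eq (F : Type) [Field F] {m : ℕ} (w : Fin (m + 1) → ℕ)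
    (x y : {v : Fin (m + 1) → AlgebraicClosure F // v ≠ 0}) :
    PW.mk F w x = PW.mk F w y ↔ wRel F w x y := by
  constructor
  · intro h
    have := Quot.eqvGen_exact h
    rwa [(wRel_equiv F w).eqvGen_iff] at this
  · intro h
    exact Quot.sound h

lemma mem_F_of_pow (F : Type) [Field F] [Fintype F] (x : AlgebraicClosure F)
    (hx : x ^ Fintype.card F = x) : ∃ a : F, algebraMap F (AlgebraicClosure F) a = x := by
  classical
  let K := AlgebraicClosure F
  have h1 : 1 < Fintype.card F := Fintype.one_lt_card
  have hne : (Polynomial.X ^ Fintype.card F - Polynomial.X : Polynomial K) ≠ 0 :=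
    FiniteField.X_pow_card_sub_X_ne_zero K h1
  set S : Finset K := Finset.univ.image (algebraMap F K)
  set R : Finset K := (Polynomial.X ^ Fintype.card F - Polynomial.X : Polynomial K).roots.toFinset
  have hSR : S ⊆ R := by
    intro y hy
    obtain ⟨a, -, rfl⟩ := Finset.mem_image.1 hy
    simp only [R, Multiset.mem_toFinset, Polynomial.mem_roots hne, Polynomial.IsRoot.def]
    simp [← map_pow, FiniteField.pow_card]
  have hS : S.card = Fintype.card F := by
    rw [Finset.card_image_of_injective _ (algebraMap F K).injective, Finset.card_univ]
  have hR : R.card ≤ Fintype.card F := by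
    refine (Multiset.toFinset_card_le _).trans ((Polynomial.card_roots' _).trans ?_)
    rw [FiniteField.X_pow_card_sub_X_natDegree_eq K h1]
  have hEq := Finset.eq_of_subset_of_card_le hSR (by omega)
  have : x ∈ R := by
    simp only [R, Multiset.mem_toFinset, Polynomial.mem_roots hne, Polynomial.IsRoot.def]
    rw [Polynomial.eval_sub, Polynomial.eval_pow, Polynomial.eval_X]
    exact sub_eq_zero.2 hx
  rw [← hEq] at this
  obtain ⟨a, -, h⟩ := Finset.mem_image.1 this
  exact ⟨a, h⟩

/-- Extension of scalars of a nonzero vector. -/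
def embV (F : Type) [Field F] {m : ℕ} (v : Fin (m + 1) → F) (hv : v ≠ 0) :
    {v : Fin (m + 1) → AlgebraicClosure F // v ≠ 0} :=
  ⟨fun i => algebraMap F (AlgebraicClosure F) (v i), by
    intro h
    apply hv
    funext i
    have := congrFun h i
    simpa using this⟩

lemma embV_rat (F : Type) [Field F] [Fintype F] {m : ℕ} (w : Fin (m + 1) → ℕ)
    (v : Fin (m + 1) → F) (hv : v ≠ 0) : PW.mk F w (embV F v hv) ∈ ratPts F w := by
  have h : (fun i => (embV F v hv).1 i ^ Fintype.card F) = (embV F v hv).1 := by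
    funext i
    simp [embV, ← map_pow, FiniteField.pow_card]
  refine ⟨embV F v hv, rfl, ?_⟩
  refine ⟨by rw [h]; exact (embV F v hv).2, ?_⟩
  congr 1
  exact Subtype.ext h

/-- Every rational orbit has a representative with rational coordinates. -/
lemma exists_rep (F : Type) [Field F] [Fintype F] {m : ℕ} (w : Fin (m + 1) → ℕ)
    (c : PW F w) (hc : c ∈ ratPts F w) :
    ∃ (v : Fin (m + 1) → F) (hv : v ≠ 0), PW.mk F w (embV F v hv) = c := by
  obtain ⟨x, hx, h, hxq⟩ := hc
  have hrel := (PW_mk_eq F w _ _).1 (hx.trans hxq.symm)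
  obtain ⟨l, hl⟩ := hrel
  simp only at hl
  have h1 : 1 < Fintype.card F := Fintype.one_lt_card
  obtain ⟨z, hz⟩ := IsAlgClosed.exists_pow_nat_eq (l : AlgebraicClosure F)
    (n := Fintype.card F - 1) (by omega)
  have hz0 : z ≠ 0 := by
    rintro rfl
    rw [zero_pow (by omega)] at hz
    exact l.ne_zero hz.symm
  have hzq : z ^ Fintype.card F = l * z := by
    rw [← hz, ← pow_succ]; congr 1; omega
  have key : ∀ i, ∃ a : F, algebraMap F (AlgebraicClosure F) a = z⁻¹ ^ w i * x.1 i := by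
    intro i
    apply mem_F_of_pow
    rw [mul_pow, hl i, ← pow_mul, mul_comm (w i), pow_mul, inv_pow, hzq, mul_inv, mul_pow, inv_pow, inv_pow]
    have : (l : AlgebraicClosure F) ≠ 0 := l.ne_zero
    field_simp
  choose v hv using key
  have hv0 : v ≠ 0 := by
    rintro rfl
    apply x.2
    funext i
    have := hv i
    simpa [hz0] using this.symm
  refine ⟨v, hv0, ?_⟩
  rw [← hx]
  rw [PW_mk_eq]
  refine ⟨Units.mk0 z hz0, fun i => ?_⟩
  simp only [embV, hv, Units.val_mk0, ← mul_assoc, ← mul_pow]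
  simp [hz0]

lemma eval_embV (F : Type) [Field F] {m : ℕ} (v : Fin (m + 1) → F) (hv : v ≠ 0)
    (f : MvPolynomial (Fin (m + 1)) F) :
    MvPolynomial.eval (embV F v hv).1 (MvPolynomial.map (algebraMap F (AlgebraicClosure F)) f)
      = algebraMap F (AlgebraicClosure F) (MvPolynomial.eval v f) := by
  rw [MvPolynomial.eval_map]
  change _ = algebraMap F (AlgebraicClosure F) (MvPolynomial.eval₂ (RingHom.id F) v f)
  rw [MvPolynomial.hom_eval₂]
  rfl

lemma eval_scale {R σ : Type} [CommRing R] [Fintype σ] (f : MvPolynomial σ R) (d : ℕ)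
    (hf : f.IsHomogeneous d) (c : R) (x : σ → R) :
    MvPolynomial.eval (fun i => c * x i) f = c ^ d * MvPolynomial.eval x f := by
  rw [MvPolynomial.eval_eq', MvPolynomial.eval_eq', Finset.mul_sum]
  refine Finset.sum_congr rfl fun b hb => ?_
  have hd : ∑ i, b i = d := by
    have := hf (MvPolynomial.mem_support_iff.1 hb)
    rw [← this, Finsupp.weight_apply, Finsupp.sum_fintype]
    · simp
    · simp
  simp only [mul_pow, Finset.prod_mul_distrib, Finset.prod_pow_eq_pow_sum, hd]
  ring

/-- Rational zeros in affine space. -/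
def affZ (F : Type) [Field F] {m : ℕ} (f : MvPolynomial (Fin (m + 1)) F) : Type :=
  {v : Fin (m + 1) → F // v ≠ 0 ∧ MvPolynomial.eval v f = 0}

instance affZ_finite (F : Type) [Field F] [Fintype F] {m : ℕ}
    (f : MvPolynomial (Fin (m + 1)) F) : Finite (affZ F f) := by
  unfold affZ; infer_instance

lemma vanish_rep (F : Type) [Field F] [Fintype F] {m : ℕ} (w : Fin (m + 1) → ℕ)
    (f : MvPolynomial (Fin (m + 1)) F) (c : vanishSet F w f) :
    ∃ a : affZ F f, PW.mk F w (embV F a.1 a.2.1) = c.1 := by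
  obtain ⟨v, hv, h⟩ := exists_rep F w c.1 c.2.1
  refine ⟨⟨v, hv, ?_⟩, h⟩
  have := c.2.2 _ h
  rw [eval_embV] at this
  simpa using this

lemma vanish_finite (F : Type) [Field F] [Fintype F] {m : ℕ} (w : Fin (m + 1) → ℕ)
    (f : MvPolynomial (Fin (m + 1)) F) : Finite (vanishSet F w f) := by
  choose r hr using vanish_rep F w f
  refine Finite.of_injective r fun c c' h => Subtype.ext ?_
  rw [← hr c, ← hr c', h]

/-- Upper bound: each rational orbit contains at least `q - 1` rational vectors. -/
lemma card_vanish_le (F : Type) [Field F] [Fintype F] {m : ℕ} (w : Fin (m + 1) → ℕ)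
    (hpos : ∀ i, 1 ≤ w i) (f : MvPolynomial (Fin (m + 1)) F) :
    (vanishSet F w f).ncard * (Fintype.card F - 1) ≤ Nat.card (affZ F f) := by
  classical
  choose r hr using vanish_rep F w f
  have key : ∀ p : vanishSet F w f × Fˣ, ∃ a : affZ F f, PW.mk F w (embV F a.1 a.2.1) = p.1.1 ∧
      ∀ i, a.1 i = (p.2 : F) ^ (w i / (Finset.univ.filter fun i => (r p.1).1 i ≠ 0).gcd w)
        * (r p.1).1 i := by
    rintro ⟨c, t⟩
    simp only
    set v := (r c).1 with hv
    set g := (Finset.univ.filter fun i => v i ≠ 0).gcd w with hg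
    have hv0 : v ≠ 0 := (r c).2.1
    obtain ⟨j, hj⟩ := Function.ne_iff.1 hv0
    simp only [Pi.zero_apply] at hj
    have hgd : ∀ i, v i ≠ 0 → g ∣ w i := fun i hi => Finset.gcd_dvd (by simp [hi])
    have hg0 : 0 < g := Nat.pos_of_dvd_of_pos (hgd j hj) (hpos j)
    obtain ⟨z, hz⟩ := IsAlgClosed.exists_pow_nat_eq
      (algebraMap F (AlgebraicClosure F) (t : F)) hg0
    have hz0 : z ≠ 0 := by
      rintro rfl
      rw [zero_pow (by omega)] at hz
      have := (map_eq_zero _).1 hz.symm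
      exact t.ne_zero this
    set u : Fin (m + 1) → F := fun i => (t : F) ^ (w i / g) * v i with hu
    have hu0 : u ≠ 0 := by
      apply Function.ne_iff.2
      exact ⟨j, by simp [hu, hj]⟩
    have hcl : PW.mk F w (embV F u hu0) = c.1 := by
      rw [← hr c, eq_comm, PW_mk_eq]
      refine ⟨Units.mk0 z hz0, fun i => ?_⟩
      change algebraMap F _ ((t : F) ^ (w i / g) * v i) = z ^ w i * algebraMap F _ (v i)
      by_cases hi : v i = 0
      · simp [hi]
      · rw [map_mul, map_pow, ← hz, ← pow_mul, Nat.mul_div_cancel' (hgd i hi)]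
    refine ⟨⟨u, hu0, ?_⟩, hcl, fun i => rfl⟩
    have := c.2.2 _ hcl
    rw [eval_embV] at this
    simpa using this
  choose φ hφ1 hφ2 using key
  have hinj : Function.Injective φ := by
    rintro ⟨c, t⟩ ⟨c', t'⟩ h
    have hc : c = c' := by
      apply Subtype.ext
      have h1 := hφ1 (c, t)
      have h2 := hφ1 (c', t')
      simp only at h1 h2
      rw [← h1, ← h2, h]
    subst hc
    have e1 := hφ2 (c, t)
    have e2 := hφ2 (c, t')
    simp only at e1 e2
    have hone : t / t' = 1 := by
      set S := Finset.univ.filter fun i => (r c).1 i ≠ 0 with hS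
      obtain ⟨j, hj⟩ := Function.ne_iff.1 (r c).2.1
      simp only [Pi.zero_apply] at hj
      have hjS : j ∈ S := by simp [hS, hj]
      have hd : orderOf (t / t') ∣ S.gcd fun i => w i / S.gcd w := by
        apply Finset.dvd_gcd
        intro i hi
        rw [orderOf_dvd_iff_pow_eq_one, div_pow, div_eq_one]
        have hi' : (r c).1 i ≠ 0 := by simpa [hS] using hi
        have := (e1 i).symm.trans ((congrArg (fun a : affZ F f => a.1 i) h).trans (e2 i))
        have := mul_right_cancel₀ hi' this
        apply Units.ext
        simpa using this
      rw [Finset.gcd_div_eq_one hjS (by have := hpos j; omega)] at hd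
      rw [← orderOf_eq_one_iff]
      exact Nat.dvd_one.1 hd
    rw [div_eq_one.1 hone]
  have := Nat.card_le_card_of_injective φ hinj
  rwa [Nat.card_prod, Nat.card_eq_fintype_card (α := Fˣ), Fintype.card_units,
    Nat.card_coe_set_eq] at this

/-- Lower bound in ordinary projective space. -/
lemma le_card_vanish (F : Type) [Field F] [Fintype F] {l : ℕ} (d : ℕ)
    (f : MvPolynomial (Fin (l + 1)) F) (hf : f.IsHomogeneous d) :
    Nat.card (affZ F f) ≤
      (vanishSet F (fun _ : Fin (l + 1) => 1) f).ncard * (Fintype.card F - 1) := by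
  classical
  choose r hr using vanish_rep F (fun _ : Fin (l + 1) => 1) f
  have key : ∀ a : affZ F f, ∃ p : vanishSet F (fun _ : Fin (l + 1) => 1) f × Fˣ,
      ∀ i, a.1 i = (p.2 : F) * (r p.1).1 i := by
    intro a
    have hmem : PW.mk F (fun _ : Fin (l + 1) => 1) (embV F a.1 a.2.1) ∈
        vanishSet F (fun _ : Fin (l + 1) => 1) f := by
      refine ⟨embV_rat F _ _ _, fun x hx => ?_⟩
      obtain ⟨c, hc⟩ := (PW_mk_eq F _ _ _).1 hx.symm
      have hx' : x.1 = fun i => (c : AlgebraicClosure F) * (embV F a.1 a.2.1).1 i := by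
        funext i
        simpa using hc i
      rw [hx', eval_scale _ d (hf.map _), eval_embV, a.2.2]
      simp
    set c : vanishSet F (fun _ : Fin (l + 1) => 1) f := ⟨_, hmem⟩ with hc
    obtain ⟨lam, hl⟩ := (PW_mk_eq F _ _ _).1 (hr c)
    have hl' : ∀ i, algebraMap F (AlgebraicClosure F) (a.1 i) =
        lam * algebraMap F (AlgebraicClosure F) ((r c).1 i) := by
      intro i
      have := hl i
      rwa [pow_one] at this
    obtain ⟨j, hj⟩ := Function.ne_iff.1 (r c).2.1
    simp only [Pi.zero_apply] at hj
    have hj' : algebraMap F (AlgebraicClosure F) ((r c).1 j) ≠ 0 := by simpa using hj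
    have hlam : (lam : AlgebraicClosure F) =
        algebraMap F (AlgebraicClosure F) (a.1 j / (r c).1 j) := by
      rw [map_div₀, hl' j]
      field_simp
    have ht : a.1 j / (r c).1 j ≠ 0 := by
      intro h
      rw [h, map_zero] at hlam
      exact lam.ne_zero hlam
    refine ⟨(c, Units.mk0 _ ht), fun i => ?_⟩
    apply (algebraMap F (AlgebraicClosure F)).injective
    rw [hl' i, hlam, map_mul, Units.val_mk0]
  choose φ hφ using key
  have hinj : Function.Injective φ := by
    intro a b h
    apply Subtype.ext
    funext i
    rw [hφ a i, hφ b i, h]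
  have := vanish_finite F (fun _ : Fin (l + 1) => 1) f
  have := Nat.card_le_card_of_injective φ hinj
  rwa [Nat.card_prod, Nat.card_eq_fintype_card (α := Fˣ), Fintype.card_units,
    Nat.card_coe_set_eq] at this

lemma card_nonzero (F : Type) [Field F] [Fintype F] (n : ℕ) :
    Nat.card {v : Fin n → F // v ≠ 0} = pSum (Fintype.card F) n * (Fintype.card F - 1) := by
  classical
  have h1 : 1 < Fintype.card F := Fintype.one_lt_card
  have h2 : Nat.card {v : Fin n → F // v ≠ 0} = Fintype.card F ^ n - 1 := by
    rw [Nat.card_eq_fintype_card, Fintype.card_subtype_compl]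
    simp
  rw [h2, pSum]
  obtain ⟨k, hk⟩ : ∃ k, Fintype.card F = k + 1 := ⟨Fintype.card F - 1, by omega⟩
  have := geom_sum_mul_add k n
  rw [hk, Nat.add_sub_cancel]
  omega


lemma card_aff_of_phi (F : Type) [Field F] [Fintype F] (m l : ℕ) (hlm : l + 1 ≤ m)
    (f : MvPolynomial (Fin (m + 1)) F) (ftil : MvPolynomial (Fin (l + 1)) F)
    (e : Fin (l + 1) → Fin (m + 1)) (he : ∀ i, (e i : ℕ) = i)
    (phi : (Fin (l + 1) → F) → (Fin (l + 1) → F)) (hphi_inj : Function.Injective phi)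
    (hphi_ne : ∀ u, u ≠ 0 → phi u ≠ 0)
    (hphi_ev : ∀ x, MvPolynomial.eval x f = 0 →
      MvPolynomial.eval (phi fun i => x (e i)) ftil = 0) :
    Nat.card (affZ F f) ≤ Nat.card (affZ F ftil) * Fintype.card F ^ (m - l)
      + pSum (Fintype.card F) (m - l) * (Fintype.card F - 1) := by
  classical
  obtain ⟨e', he'⟩ : ∃ e' : Fin (m - l) → Fin (m + 1), ∀ i, (e' i : ℕ) = l + 1 + i :=
    ⟨fun i => ⟨l + 1 + i, by have := i.isLt; omega⟩, fun i => rfl⟩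
  have hvec : ∀ a b : Fin (m + 1) → F, (fun i => a (e i)) = (fun i => b (e i)) →
      (fun i => a (e' i)) = (fun i => b (e' i)) → a = b := by
    intro a b hab hab'
    funext i
    by_cases hi : (i : ℕ) < l + 1
    · have hi' : e ⟨i, hi⟩ = i := Fin.ext (he _)
      have := congrFun hab ⟨i, hi⟩
      simpa only [hi'] using this
    · have hlt : (i : ℕ) - (l + 1) < m - l := by have := i.isLt; omega
      have hi' : e' ⟨i - (l + 1), hlt⟩ = i := by
        apply Fin.ext
        rw [he']
        simp only
        omega
      have := congrFun hab' ⟨i - (l + 1), hlt⟩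
      simpa only [hi'] using this
  have hex : ∀ a : affZ F f,
      ∃ p : (affZ F ftil × (Fin (m - l) → F)) ⊕ {v : Fin (m - l) → F // v ≠ 0},
      ((fun i => a.1 (e i)) = 0 ∧ ∃ v, p = Sum.inr v ∧ v.1 = fun i => a.1 (e' i)) ∨
      (∃ b, p = Sum.inl b ∧ b.1.1 = phi (fun i => a.1 (e i)) ∧ b.2 = fun i => a.1 (e' i)) := by
    intro a
    by_cases hu : (fun i => a.1 (e i)) = 0
    · refine ⟨Sum.inr ⟨fun i => a.1 (e' i), fun hv => a.2.1 (hvec _ _ hu hv)⟩, Or.inl ⟨hu, _, rfl, rfl⟩⟩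
    · exact ⟨Sum.inl (⟨phi (fun i => a.1 (e i)), hphi_ne _ hu, hphi_ev _ a.2.2⟩,
        fun i => a.1 (e' i)), Or.inr ⟨_, rfl, rfl, rfl⟩⟩
  choose Phi hPhi using hex
  have hinj : Function.Injective Phi := by
    intro a b h
    apply Subtype.ext
    rcases hPhi a with ⟨ha, v, hv, hv'⟩ | ⟨v, hv, hv', hv''⟩ <;>
    rcases hPhi b with ⟨hb, u, hu, hu'⟩ | ⟨u, hu, hu', hu''⟩
    · have : v = u := Sum.inr.inj (hv.symm.trans (h.trans hu))
      subst this
      exact hvec _ _ (ha.trans hb.symm) (hv'.symm.trans hu')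
    · exact absurd (hv.symm.trans (h.trans hu)) (by simp)
    · exact absurd (hv.symm.trans (h.trans hu)) (by simp)
    · have : v = u := Sum.inl.inj (hv.symm.trans (h.trans hu))
      subst this
      exact hvec _ _ (hphi_inj (hv'.symm.trans hu')) (hv''.symm.trans hu'')
  have hcard := Nat.card_le_card_of_injective Phi hinj
  rw [Nat.card_sum, Nat.card_prod, card_nonzero, Nat.card_eq_fintype_card (α := Fin (m - l) → F),
    Fintype.card_fun, Fintype.card_fin] at hcard
  exact hcard

lemma exists_phi (F : Type) [Field F] (l W D : ℕ) (hW1 : 1 ≤ W)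
    (ftil : MvPolynomial (Fin (l + 1)) F) (hftilh : ftil.IsHomogeneous D) :
    ∃ phi : (Fin (l + 1) → F) → (Fin (l + 1) → F), Function.Injective phi ∧
      (∀ u, u ≠ 0 → phi u ≠ 0) ∧
      ∀ u, MvPolynomial.eval (fun i : Fin (l + 1) => if (i : ℕ) = 0 then u i ^ W else u i) ftil = 0 →
        MvPolynomial.eval (phi u) ftil = 0 := by
  classical
  let psi : (Fin (l + 1) → F) → (Fin (l + 1) → F) :=
    fun u i => if (i : ℕ) = 0 then u i ^ W else u i
  -- scaling factor
  let s : F → F := fun a => if a = 0 then 1 else a / a ^ W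
  have hs : ∀ a, s a ≠ 0 := by
    intro a
    by_cases ha : a = 0
    · simp [s, ha]
    · simp [s, ha]
  let phi : (Fin (l + 1) → F) → (Fin (l + 1) → F) := fun u i => s (u 0) * psi u i
  have hphi0 : ∀ u, phi u 0 = u 0 := by
    intro u
    by_cases ha : u 0 = 0
    · simp [phi, psi, ha]
      omega
    · simp [phi, psi, s, ha]
  have hphi_inj : Function.Injective phi := by
    intro u u' h
    have h0 : u 0 = u' 0 := by rw [← hphi0 u, ← hphi0 u', h]
    funext i
    by_cases hi : (i : ℕ) = 0
    · have : i = 0 := Fin.ext hi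
      rw [this, h0]
    · have := congrFun h i
      simp only [phi, psi, hi, if_false, h0] at this
      exact mul_left_cancel₀ (hs _) this
  have hphiz : phi 0 = 0 := by
    funext i
    by_cases hi : (i : ℕ) = 0
    · simp [phi, psi, hi]; omega
    · simp only [phi, psi, hi, if_false, Pi.zero_apply, mul_zero]
  have hphi_ne : ∀ u, u ≠ 0 → phi u ≠ 0 := by
    intro u hu h
    exact hu (hphi_inj (h.trans hphiz.symm))
  refine ⟨phi, hphi_inj, hphi_ne, ?_⟩
  intro u hu
  have := eval_scale ftil _ hftilh (s (u 0)) (psi u)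
  rw [show MvPolynomial.eval (psi u) ftil = 0 from hu, mul_zero] at this
  exact this

lemma eval_sub_eq (F : Type) [Field F] (m l : ℕ)
    (ftil : MvPolynomial (Fin (l + 1)) F)
    (g : Fin (l + 1) → MvPolynomial (Fin (m + 1)) F) (x : Fin (m + 1) → F) :
    MvPolynomial.eval x (MvPolynomial.aeval g ftil)
      = MvPolynomial.eval (fun i => MvPolynomial.eval x (g i)) ftil := by
  induction ftil using MvPolynomial.induction_on with
  | C a => simp
  | add p q hp hq => rw [map_add, map_add, map_add, hp, hq]
  | mul_X p i hp => rw [map_mul, map_mul, map_mul, hp, MvPolynomial.aeval_X, MvPolynomial.eval_X]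

/-- Delorme reduction step inside Lemma 3.5: if `f` only involves
`x_0, …, x_ℓ` with all exponents of `x_0` divisible by `w_1`, then the number of
rational zeroes of `f` on `ℙ(w)` is controlled by the zeroes of the reduced
polynomial `f̃` on `ℙ^ℓ`. -/
theorem stmt11 (F : Type) [Field F] [Fintype F] (m ℓ : ℕ) (w : Fin (m + 1) → ℕ)
    (hℓ1 : 1 ≤ ℓ) (hℓm : ℓ + 1 ≤ m)
    (hpos : ∀ i, 1 ≤ w i)
    (hw0 : w ⟨0, by omega⟩ = 1)
    (hweq : ∀ i : Fin (m + 1), 1 ≤ (i : ℕ) → (i : ℕ) ≤ ℓ → w i = w ⟨1, by omega⟩)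
    (hlt : w ⟨ℓ, by omega⟩ < w ⟨ℓ + 1, by omega⟩)
    (hmono : ∀ i j : Fin (m + 1), ℓ + 1 ≤ (i : ℕ) → i ≤ j → w i ≤ w j)
    (d : ℕ) (hdvd : w ⟨1, by omega⟩ ∣ d)
    (f : MvPolynomial (Fin (m + 1)) F) (hf0 : f ≠ 0)
    (hfh : MvPolynomial.IsWeightedHomogeneous w f d)
    (hvars : ∀ b ∈ f.support, ∀ j : Fin (m + 1), ℓ < (j : ℕ) → b j = 0)
    (hx0 : ∀ b ∈ f.support, w ⟨1, by omega⟩ ∣ b ⟨0, by omega⟩)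
    (ftil : MvPolynomial (Fin (ℓ + 1)) F)
    (hftilh : ftil.IsHomogeneous (d / w ⟨1, by omega⟩))
    (hsub : MvPolynomial.aeval (fun i : Fin (ℓ + 1) =>
        if (i : ℕ) = 0 then
          (X ⟨0, by omega⟩ : MvPolynomial (Fin (m + 1)) F) ^ w ⟨1, by omega⟩
        else X ⟨(i : ℕ), by exact lt_of_lt_of_le i.isLt (by omega)⟩) ftil = f) :
    (vanishSet F w f).ncard ≤
      (vanishSet F (fun _ : Fin (ℓ + 1) => 1) ftil).ncard * Fintype.card F ^ (m - ℓ)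
        + pSum (Fintype.card F) (m - ℓ) := by
  classical
  have h1 : 1 < Fintype.card F := Fintype.one_lt_card
  obtain ⟨phi, hinj, hne, hphi⟩ := exists_phi F ℓ (w ⟨1, by omega⟩) _ (hpos _) ftil hftilh
  have hcard := card_aff_of_phi F m ℓ hℓm f ftil (fun i => ⟨i, by have := i.isLt; omega⟩)
    (fun i => rfl) phi hinj hne (by
      intro x hx
      apply hphi
      rw [← hsub, eval_sub_eq] at hx
      rw [← hx]
      congr 2
      funext i
      by_cases hi : (i : ℕ) = 0
      · rw [if_pos hi, if_pos hi, map_pow, MvPolynomial.eval_X]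
        congr 2
        exact Fin.ext hi
      · rw [if_neg hi, if_neg hi, MvPolynomial.eval_X])
  have hA := card_vanish_le F w hpos f
  have hB := le_card_vanish F _ ftil hftilh
  generalize (vanishSet F w f).ncard = a at hA ⊢
  generalize (vanishSet F (fun _ : Fin (ℓ + 1) => 1) ftil).ncard = b at hB ⊢
  generalize Nat.card (affZ F f) = A at hA hcard
  generalize Nat.card (affZ F ftil) = B at hB hcard
  refine Nat.le_of_mul_le_mul_right (c := Fintype.card F - 1) ?_ (by omega)
  have h3 := Nat.mul_le_mul_right (Fintype.card F ^ (m - ℓ)) hB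
  have h4 := hA.trans (hcard.trans (Nat.add_le_add_right h3 _))
  refine h4.trans (le_of_eq ?_)
  ring

end
end
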